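/- arXiv:math/9201215 — 2 statements merged into one kernel-verified Lean document; each statement's English description precedes it below -/
import Mathlib

section
/- Let X, Y and Z be Banach spaces and let T : X ⊗̂_ε Y → Z be an integral operator. Then T# : X → I(Y,Z) is a 1-summing operator with π₁(T#) ≤ ‖T‖_int. -/
set_option maxHeartbeats 1000000
set_option synthInstance.maxHeartbeats 400000
set_option maxSynthPendingDepth 3

noncomputable section

open scoped BigOperators NNReal ENNReal
open NormedSpace

/-- The scalar field. -/
notation "𝕂" => ℝ

section Summing

variable {E F : Type} [NormedAddCommGroup E] [NormedSpace 𝕂 E]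
  [NormedAddCommGroup F] [NormedSpace 𝕂 F]

/-- The weak ℓ_q norm of a finite family of vectors:
`sup { (Σ_i ‖e*(e_i)‖^q)^(1/q) : e* ∈ E*, ‖e*‖ ≤ 1 }`. -/
def weakNorm (q : ℝ) {n : ℕ} (e : Fin n → E) : ℝ :=
  ⨆ f : {f : StrongDual 𝕂 E // ‖f‖ ≤ 1}, (∑ i, ‖(f : StrongDual 𝕂 E) (e i)‖ ^ q) ^ (1 / q)

/-- `T` satisfies the (p,q)-summing inequality with constant `C`:
`(Σ_i ‖T e_i‖^p)^(1/p) ≤ C · sup { (Σ_i ‖e*(e_i)‖^q)^(1/q) : ‖e*‖ ≤ 1 }`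
for all finite families `e_1, …, e_n`. -/
def SummingWithC (p q C : ℝ) (T : E →L[𝕂] F) : Prop :=
  ∀ (n : ℕ) (e : Fin n → E),
    (∑ i, ‖T (e i)‖ ^ p) ^ (1 / p) ≤ C * weakNorm q e

/-- `T` is (p,q)-summing. -/
def IsPQSumming (p q : ℝ) (T : E →L[𝕂] F) : Prop :=
  ∃ C, 0 ≤ C ∧ SummingWithC p q C T

/-- `T` is p-summing. -/
def IsPSumming (p : ℝ) (T : E →L[𝕂] F) : Prop := IsPQSumming p p T

/-- The p-summing norm `π_p(T)`: the least admissible constant. -/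
def pNorm (p : ℝ) (T : E →L[𝕂] F) : ℝ :=
  sInf {C | 0 ≤ C ∧ SummingWithC p p C T}

end Summing

section Eps

variable {X Y : Type} [NormedAddCommGroup X] [NormedSpace 𝕂 X]
  [NormedAddCommGroup Y] [NormedSpace 𝕂 Y]

/-- The rank-one operator `x* ↦ x*(x) • y`, realizing the elementary tensor `x ⊗ y`
inside the space of operators from `X*` to `Y`. -/
def elemTensor (x : X) (y : Y) : StrongDual 𝕂 X →L[𝕂] Y :=
  (inclusionInDoubleDual 𝕂 X x).smulRight y

/-- The injective tensor product `X ⊗̂_ε Y`, as a submodule of the operators `X* → Y`: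
the closure of the span of the elementary tensors.  (The operator norm of
`x* ↦ Σ_i x*(x_i) • y_i` is exactly the injective tensor norm of `Σ_i x_i ⊗ y_i`.) -/
def epsSub (X Y : Type) [NormedAddCommGroup X] [NormedSpace 𝕂 X]
    [NormedAddCommGroup Y] [NormedSpace 𝕂 Y] : Submodule 𝕂 (StrongDual 𝕂 X →L[𝕂] Y) :=
  (Submodule.span 𝕂 (Set.range fun p : X × Y => elemTensor p.1 p.2)).topologicalClosure

/-- The injective tensor product `X ⊗̂_ε Y` as a normed space. -/
def EpsTensor (X Y : Type) [NormedAddCommGroup X] [NormedSpace 𝕂 X]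
    [NormedAddCommGroup Y] [NormedSpace 𝕂 Y] : Type := ↥(epsSub X Y)

instance : NormedAddCommGroup (EpsTensor X Y) :=
  inferInstanceAs (NormedAddCommGroup ↥(epsSub X Y))

instance : NormedSpace 𝕂 (EpsTensor X Y) :=
  inferInstanceAs (NormedSpace 𝕂 ↥(epsSub X Y))

instance [CompleteSpace Y] : CompleteSpace (EpsTensor X Y) := by
  have h : IsClosed ((epsSub X Y : Submodule 𝕂 (StrongDual 𝕂 X →L[𝕂] Y)) : Set (StrongDual 𝕂 X →L[𝕂] Y)) := by
    unfold epsSub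
    exact Submodule.isClosed_topologicalClosure _
  exact h.completeSpace_coe

/-- The elementary tensor `x ⊗ y` as an element of `X ⊗̂_ε Y`. -/
def tmulEps (x : X) (y : Y) : EpsTensor X Y :=
  show ↥(epsSub X Y) from
    ⟨elemTensor x y,
      Submodule.le_topologicalClosure _ (Submodule.subset_span ⟨(x, y), rfl⟩)⟩

/-- For fixed `x : X`, the bounded linear map `y ↦ x ⊗ y` from `Y` to `X ⊗̂_ε Y`. -/
def tmulLeft (x : X) : Y →L[𝕂] EpsTensor X Y :=
  show Y →L[𝕂] ↥(epsSub X Y) from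
    ContinuousLinearMap.codRestrict
      (ContinuousLinearMap.smulRightL 𝕂 (StrongDual 𝕂 X) Y (inclusionInDoubleDual 𝕂 X x))
      (epsSub X Y)
      (fun y => Submodule.le_topologicalClosure _ (Submodule.subset_span ⟨(x, y), rfl⟩))

variable {Z : Type} [NormedAddCommGroup Z] [NormedSpace 𝕂 Z]

/-- The operator `T# x : Y → Z` induced by `T : X ⊗̂_ε Y → Z`, i.e. `(T# x) y = T (x ⊗ y)`. -/
def sharp (T : EpsTensor X Y →L[𝕂] Z) (x : X) : Y →L[𝕂] Z :=
  T.comp (tmulLeft x)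

end Eps

section Integral

variable {E F : Type} [NormedAddCommGroup E] [NormedSpace 𝕂 E]
  [NormedAddCommGroup F] [NormedSpace 𝕂 F]

/-- `Φ ∈ (E ⊗̂_ε F*)*` extends the bilinear form `(e, f) ↦ f (T e)` associated to `T`. -/
def ExtendsOf (T : E →L[𝕂] F) (Φ : StrongDual 𝕂 (EpsTensor E (StrongDual 𝕂 F))) : Prop :=
  ∀ (e : E) (f : StrongDual 𝕂 F), Φ (tmulEps e f) = f (T e)

/-- `T : E → F` is an integral operator: the bilinear form `(e, f) ↦ f(T e)` extends to a
bounded linear functional on `E ⊗̂_ε F*`. -/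
def IsIntegralOp (T : E →L[𝕂] F) : Prop := ∃ Φ, ExtendsOf T Φ

/-- The integral norm `‖T‖_int` of `T`: the norm of the extending functional
(the extension is unique, since the elementary tensors span a dense subspace). -/
def integralNorm (T : E →L[𝕂] F) : ℝ :=
  sInf {c | ∃ Φ, ExtendsOf T Φ ∧ ‖Φ‖ = c}

end Integral

section IntegralSpace

variable (Y Z : Type) [NormedAddCommGroup Y] [NormedSpace 𝕂 Y]
  [NormedAddCommGroup Z] [NormedSpace 𝕂 Z]

/-- The space `I(Y,Z)` of integral operators from `Y` to `Z` with the integral norm,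
realized isometrically as the subspace of `(Y ⊗̂_ε Z*)*` consisting of those functionals
that extend the bilinear form of a (necessarily unique) operator `T : Y → Z`. -/
def IntegralSub : Submodule 𝕂 (StrongDual 𝕂 (EpsTensor Y (StrongDual 𝕂 Z))) where
  carrier := {Φ | ∃ T : Y →L[𝕂] Z, ExtendsOf T Φ}
  add_mem' := by
    rintro Φ Ψ ⟨T, hT⟩ ⟨S, hS⟩
    exact ⟨T + S, fun e f => by
      simp [ExtendsOf, ContinuousLinearMap.add_apply, map_add, hT e f, hS e f]⟩
  zero_mem' := ⟨0, fun e f => by simp⟩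
  smul_mem' := by
    rintro c Φ ⟨T, hT⟩
    exact ⟨c • T, fun e f => by
      simp [ContinuousLinearMap.smul_apply, map_smul, hT e f]⟩

/-- The space `I(Y,Z)` of integral operators with the integral norm, as a normed space. -/
def IntegralSpace : Type := ↥(IntegralSub Y Z)

instance : NormedAddCommGroup (IntegralSpace Y Z) :=
  inferInstanceAs (NormedAddCommGroup ↥(IntegralSub Y Z))

instance : NormedSpace 𝕂 (IntegralSpace Y Z) :=
  inferInstanceAs (NormedSpace 𝕂 ↥(IntegralSub Y Z))

variable {Y Z}

/-- The functional in `(Y ⊗̂_ε Z*)*` underlying an element of `I(Y,Z)`. -/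
def IntegralSpace.toFunctional (Φ : IntegralSpace Y Z) : StrongDual 𝕂 (EpsTensor Y (StrongDual 𝕂 Z)) :=
  (show ↥(IntegralSub Y Z) from Φ).1

end IntegralSpace

/-- The inclusion of the injective tensor product into the space of operators. -/
def epsVal {X Y : Type} [NormedAddCommGroup X] [NormedSpace ℝ X]
    [NormedAddCommGroup Y] [NormedSpace ℝ Y] : EpsTensor X Y →L[ℝ] (StrongDual ℝ X →L[ℝ] Y) :=
  (epsSub X Y).subtypeL

theorem epsVal_norm {X Y : Type} [NormedAddCommGroup X] [NormedSpace ℝ X]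
    [NormedAddCommGroup Y] [NormedSpace ℝ Y] (u : EpsTensor X Y) : ‖epsVal u‖ = ‖u‖ := rfl

theorem epsVal_mem {X Y : Type} [NormedAddCommGroup X] [NormedSpace ℝ X]
    [NormedAddCommGroup Y] [NormedSpace ℝ Y] (u : EpsTensor X Y) : epsVal u ∈ epsSub X Y :=
  (show ↥(epsSub X Y) from u).2

theorem epsVal_tmul {X Y : Type} [NormedAddCommGroup X] [NormedSpace ℝ X]
    [NormedAddCommGroup Y] [NormedSpace ℝ Y] (x : X) (y : Y) :
    epsVal (tmulEps x y) = elemTensor x y := rfl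

theorem elemTensor_apply {X Y : Type} [NormedAddCommGroup X] [NormedSpace ℝ X]
    [NormedAddCommGroup Y] [NormedSpace ℝ Y] (x : X) (y : Y) (f : StrongDual ℝ X) :
    elemTensor x y f = f x • y := rfl

theorem epsVal_tmulLeft {X Y : Type} [NormedAddCommGroup X] [NormedSpace ℝ X]
    [NormedAddCommGroup Y] [NormedSpace ℝ Y] (x : X) (y : Y) :
    (tmulLeft x y : EpsTensor X Y) = tmulEps x y := rfl

/-- Tensoring an operator with the identity, at the level of operators. -/
def preL {E F : Type} (W : Type) [NormedAddCommGroup E] [NormedSpace ℝ E]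
    [NormedAddCommGroup F] [NormedSpace ℝ F] [NormedAddCommGroup W] [NormedSpace ℝ W]
    (S : E →L[ℝ] F) : (StrongDual ℝ E →L[ℝ] W) →L[ℝ] (StrongDual ℝ F →L[ℝ] W) :=
  (ContinuousLinearMap.compL ℝ (StrongDual ℝ F) (StrongDual ℝ E) W).flip
    ((ContinuousLinearMap.compL ℝ E F ℝ).flip S)

theorem preL_apply {E F W : Type} [NormedAddCommGroup E] [NormedSpace ℝ E]
    [NormedAddCommGroup F] [NormedSpace ℝ F] [NormedAddCommGroup W] [NormedSpace ℝ W]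
    (S : E →L[ℝ] F) (u : StrongDual ℝ E →L[ℝ] W) (φ : StrongDual ℝ F) :
    preL W S u φ = u (φ.comp S) := rfl

theorem preL_mem {E F W : Type} [NormedAddCommGroup E] [NormedSpace ℝ E]
    [NormedAddCommGroup F] [NormedSpace ℝ F] [NormedAddCommGroup W] [NormedSpace ℝ W]
    (S : E →L[ℝ] F) (u : StrongDual ℝ E →L[ℝ] W) (hu : u ∈ epsSub E W) :
    preL W S u ∈ epsSub F W := by
  unfold epsSub at hu ⊢
  refine map_mem_closure (preL W S).continuous hu ?_
  intro a ha
  change a ∈ Submodule.span ℝ _ at ha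
  change preL W S a ∈ Submodule.span ℝ _
  induction ha using Submodule.span_induction with
  | mem a h =>
    obtain ⟨p, rfl⟩ := h
    refine Submodule.subset_span ⟨(S p.1, p.2), ?_⟩
    ext φ
    rfl
  | zero => rw [map_zero]; exact Submodule.zero_mem _
  | add a b _ _ h1 h2 => rw [map_add]; exact Submodule.add_mem _ h1 h2
  | smul c a _ h => rw [map_smul]; exact Submodule.smul_mem _ c h

/-- Tensoring an operator with the identity. -/
def epsMap {E F : Type} (W : Type) [NormedAddCommGroup E] [NormedSpace ℝ E]
    [NormedAddCommGroup F] [NormedSpace ℝ F] [NormedAddCommGroup W] [NormedSpace ℝ W]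
    (S : E →L[ℝ] F) : EpsTensor E W →L[ℝ] EpsTensor F W :=
  show EpsTensor E W →L[ℝ] ↥(epsSub F W) from
  ((preL W S).comp epsVal).codRestrict (epsSub F W) fun u => preL_mem S _ (epsVal_mem u)

theorem epsVal_epsMap {E F W : Type} [NormedAddCommGroup E] [NormedSpace ℝ E]
    [NormedAddCommGroup F] [NormedSpace ℝ F] [NormedAddCommGroup W] [NormedSpace ℝ W]
    (S : E →L[ℝ] F) (u : EpsTensor E W) (φ : StrongDual ℝ F) :
    epsVal (epsMap W S u) φ = epsVal u (φ.comp S) := rfl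

theorem epsMap_tmul {E F W : Type} [NormedAddCommGroup E] [NormedSpace ℝ E]
    [NormedAddCommGroup F] [NormedSpace ℝ F] [NormedAddCommGroup W] [NormedSpace ℝ W]
    (S : E →L[ℝ] F) (e : E) (w : W) :
    epsMap W S (tmulEps e w) = tmulEps (S e) w := rfl

/-- Slicing an element of the injective tensor product by a functional gives a vector. -/
theorem exists_slice {Y W : Type} [NormedAddCommGroup Y] [NormedSpace ℝ Y] [CompleteSpace Y]
    [NormedAddCommGroup W] [NormedSpace ℝ W] (u : EpsTensor Y W) (z : StrongDual ℝ W) :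
    ∃ y : Y, ‖y‖ ≤ ‖z‖ * ‖u‖ ∧ ∀ ψ : StrongDual ℝ Y, z (epsVal u ψ) = ψ y := by
  let R : Submodule ℝ (StrongDual ℝ (StrongDual ℝ Y)) :=
    LinearMap.range (inclusionInDoubleDualLi ℝ (E := Y)).toLinearMap
  have hRc : IsClosed (R : Set (StrongDual ℝ (StrongDual ℝ Y))) := by
    have := (inclusionInDoubleDualLi ℝ (E := Y)).isometry.isClosedEmbedding.isClosed_range
    exact this
  let G : (StrongDual ℝ Y →L[ℝ] W) →L[ℝ] StrongDual ℝ (StrongDual ℝ Y) :=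
    ContinuousLinearMap.compL ℝ (StrongDual ℝ Y) W ℝ z
  have key : epsSub Y W ≤ R.comap (G : (StrongDual ℝ Y →L[ℝ] W) →ₗ[ℝ] _) := by
    unfold epsSub
    refine Submodule.topologicalClosure_minimal _ ?_ (hRc.preimage G.continuous)
    rw [Submodule.span_le]
    rintro _ ⟨p, rfl⟩
    refine ⟨z p.2 • p.1, ?_⟩
    ext ψ
    change ψ (z p.2 • p.1) = z (ψ p.1 • p.2)
    simp [mul_comm]
  obtain ⟨y, hy⟩ := key (epsVal_mem u)
  have hy' : inclusionInDoubleDualLi ℝ y = z.comp (epsVal u) := hy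
  refine ⟨y, ?_, fun ψ => ?_⟩
  · rw [← (inclusionInDoubleDualLi ℝ (E := Y)).norm_map y, hy', ← epsVal_norm u]
    exact ContinuousLinearMap.opNorm_comp_le _ _
  · have := congrArg (fun g => g ψ) hy'
    exact this.symm

theorem le_weakNorm_one {X : Type} [NormedAddCommGroup X] [NormedSpace ℝ X] {n : ℕ}
    (v : Fin n → X) (f : StrongDual ℝ X) (hf : ‖f‖ ≤ 1) : ∑ i, ‖f (v i)‖ ≤ weakNorm 1 v := by
  unfold weakNorm
  simp only [Real.rpow_one, div_one]
  refine le_ciSup (f := fun f : {f : StrongDual ℝ X // ‖f‖ ≤ 1} =>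
    ∑ i, ‖(f : StrongDual ℝ X) (v i)‖) ?_ ⟨f, hf⟩
  refine ⟨∑ i, ‖v i‖, ?_⟩
  rintro _ ⟨g, rfl⟩
  exact Finset.sum_le_sum fun i _ => g.1.le_of_opNorm_le g.2 (v i) |>.trans (by simp)

theorem weakNorm_one_nonneg {X : Type} [NormedAddCommGroup X] [NormedSpace ℝ X] {n : ℕ}
    (v : Fin n → X) : 0 ≤ weakNorm 1 v :=
  (Finset.sum_nonneg fun _ _ => norm_nonneg _).trans (le_weakNorm_one v 0 (by simp))

theorem sum_le_weakNorm {X : Type} [NormedAddCommGroup X] [NormedSpace ℝ X] {n : ℕ}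
    (v : Fin n → X) (f : StrongDual ℝ X) : ∑ i, ‖f (v i)‖ ≤ weakNorm 1 v * ‖f‖ := by
  rcases eq_or_ne f 0 with rfl | hf
  · simp
  · have hpos : 0 < ‖f‖ := norm_pos_iff.2 hf
    have := le_weakNorm_one v (‖f‖⁻¹ • f) (by
      rw [norm_smul, norm_inv, norm_norm, inv_mul_cancel₀ hpos.ne'])
    simp only [ContinuousLinearMap.smul_apply, norm_smul, norm_inv, norm_norm,
      ← Finset.mul_sum] at this
    rwa [inv_mul_le_iff₀ hpos, mul_comm] at this

theorem norm_sum_tmul_le {X Y : Type} [NormedAddCommGroup X] [NormedSpace ℝ X]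
    [NormedAddCommGroup Y] [NormedSpace ℝ Y] {n : ℕ} (v : Fin n → X) (y : Fin n → Y) (c : ℝ)
    (hc : 0 ≤ c) (hy : ∀ i, ‖y i‖ ≤ c) :
    ‖∑ i, (tmulEps (v i) (y i) : EpsTensor X Y)‖ ≤ weakNorm 1 v * c := by
  rw [← epsVal_norm, map_sum]
  refine ContinuousLinearMap.opNorm_le_bound _ (mul_nonneg (weakNorm_one_nonneg v) hc) fun f => ?_
  rw [ContinuousLinearMap.sum_apply]
  calc ‖∑ i, epsVal (tmulEps (v i) (y i)) f‖ ≤ ∑ i, ‖f (v i)‖ * c := by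
        refine norm_sum_le_of_le _ fun i _ => ?_
        rw [epsVal_tmul, elemTensor_apply, norm_smul]
        exact mul_le_mul_of_nonneg_left (hy i) (norm_nonneg _)
    _ = (∑ i, ‖f (v i)‖) * c := by rw [Finset.sum_mul]
    _ ≤ weakNorm 1 v * ‖f‖ * c := mul_le_mul_of_nonneg_right (sum_le_weakNorm v f) hc
    _ = weakNorm 1 v * c * ‖f‖ := by ring

theorem norm_sum_epsMap_le {X Y Z : Type} [NormedAddCommGroup X] [NormedSpace ℝ X]
    [NormedAddCommGroup Y] [NormedSpace ℝ Y] [CompleteSpace Y]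
    [NormedAddCommGroup Z] [NormedSpace ℝ Z] {n : ℕ} (v : Fin n → X)
    (u : Fin n → EpsTensor Y (StrongDual ℝ Z)) (hu : ∀ i, ‖u i‖ ≤ 1) :
    ‖∑ i, epsMap (StrongDual ℝ Z) (tmulLeft (v i) : Y →L[ℝ] EpsTensor X Y) (u i)‖
      ≤ weakNorm 1 v := by
  have hw := weakNorm_one_nonneg v
  rw [← epsVal_norm, map_sum]
  refine ContinuousLinearMap.opNorm_le_bound _ hw fun φ => ?_
  refine ContinuousLinearMap.opNorm_le_bound _ (mul_nonneg hw (norm_nonneg _)) fun z => ?_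
  have hz : ‖inclusionInDoubleDual ℝ Z z‖ ≤ ‖z‖ := double_dual_bound ℝ Z z
  choose y hy1 hy2 using fun i => exists_slice (u i) (inclusionInDoubleDual ℝ Z z)
  have hy3 : ∀ i, ‖y i‖ ≤ ‖z‖ := fun i => (hy1 i).trans <| by
    calc _ ≤ ‖z‖ * 1 := mul_le_mul hz (hu i) (norm_nonneg _) (norm_nonneg _)
      _ = ‖z‖ := mul_one _
  have e : ((∑ i, epsVal (epsMap (StrongDual ℝ Z)
      (tmulLeft (v i) : Y →L[ℝ] EpsTensor X Y) (u i))) φ) z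
      = φ (∑ i, tmulEps (v i) (y i)) := by
    rw [ContinuousLinearMap.sum_apply, ContinuousLinearMap.sum_apply, map_sum]
    exact Finset.sum_congr rfl fun i _ => hy2 i (φ.comp (tmulLeft (v i)))
  rw [e]
  calc _ ≤ ‖φ‖ * ‖∑ i, tmulEps (v i) (y i)‖ := φ.le_opNorm _
    _ ≤ ‖φ‖ * (weakNorm 1 v * ‖z‖) :=
      mul_le_mul_of_nonneg_left (norm_sum_tmul_le v y _ (norm_nonneg _) hy3) (norm_nonneg _)
    _ = _ := by ring

theorem exists_near_norm {E : Type} [NormedAddCommGroup E] [NormedSpace ℝ E]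
    (f : StrongDual ℝ E) {ε : ℝ} (hε : 0 < ε) : ∃ u : E, ‖u‖ ≤ 1 ∧ ‖f‖ - ε ≤ f u := by
  obtain ⟨x, hx, hfx⟩ := f.exists_lt_apply_of_lt_opNorm (show ‖f‖ - ε < ‖f‖ by linarith)
  rcases le_total 0 (f x) with h | h
  · rw [Real.norm_of_nonneg h] at hfx
    exact ⟨x, hx.le, hfx.le⟩
  · rw [Real.norm_of_nonpos h] at hfx
    exact ⟨-x, by rw [norm_neg]; exact hx.le, by rw [map_neg]; exact hfx.le⟩

theorem extends_sharp {X Y Z : Type} [NormedAddCommGroup X] [NormedSpace ℝ X]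
    [NormedAddCommGroup Y] [NormedSpace ℝ Y] [NormedAddCommGroup Z] [NormedSpace ℝ Z]
    (T : EpsTensor X Y →L[ℝ] Z) (Φ : StrongDual ℝ (EpsTensor (EpsTensor X Y) (StrongDual ℝ Z)))
    (h : ExtendsOf T Φ) (x : X) :
    ExtendsOf (sharp T x) (Φ.comp (epsMap (StrongDual ℝ Z) (tmulLeft x))) := by
  intro y f
  rw [ContinuousLinearMap.comp_apply, epsMap_tmul, h]
  rfl

theorem integralNorm_le {E F : Type} [NormedAddCommGroup E] [NormedSpace ℝ E]
    [NormedAddCommGroup F] [NormedSpace ℝ F] (T : E →L[ℝ] F)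
    (Φ : StrongDual ℝ (EpsTensor E (StrongDual ℝ F))) (h : ExtendsOf T Φ) :
    integralNorm T ≤ ‖Φ‖ :=
  csInf_le ⟨0, by rintro _ ⟨Ψ, _, rfl⟩; exact norm_nonneg _⟩ ⟨Φ, h, rfl⟩

theorem statement5 (X Y Z : Type)
    [NormedAddCommGroup X] [NormedSpace ℝ X] [CompleteSpace X]
    [NormedAddCommGroup Y] [NormedSpace ℝ Y] [CompleteSpace Y]
    [NormedAddCommGroup Z] [NormedSpace ℝ Z] [CompleteSpace Z]
    (T : EpsTensor X Y →L[ℝ] Z) (hT : IsIntegralOp T) :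
    (∀ x : X, IsIntegralOp (sharp T x)) ∧
    ∀ (n : ℕ) (v : Fin n → X),
      ∑ i, integralNorm (sharp T (v i)) ≤ integralNorm T * weakNorm 1 v := by
  obtain ⟨Φ₀, hΦ₀⟩ := hT
  refine ⟨fun x => ⟨_, extends_sharp T Φ₀ hΦ₀ x⟩, fun n v => ?_⟩
  have main : ∀ Φ, ExtendsOf T Φ →
      ∑ i, integralNorm (sharp T (v i)) ≤ ‖Φ‖ * weakNorm 1 v := by
    intro Φ hΦ
    refine (Finset.sum_le_sum fun i _ =>
      integralNorm_le _ _ (extends_sharp T Φ hΦ (v i))).trans ?_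
    refine le_of_forall_pos_le_add fun δ hδ => ?_
    have hε : 0 < δ / (n + 1 : ℝ) := by positivity
    choose u hu1 hu2 using fun i =>
      exists_near_norm (Φ.comp (epsMap (StrongDual ℝ Z)
        (tmulLeft (v i) : Y →L[ℝ] EpsTensor X Y))) hε
    have h1 := Finset.sum_le_sum fun i (_ : i ∈ Finset.univ) => hu2 i
    rw [Finset.sum_sub_distrib] at h1
    have h2 : ∑ i, (Φ.comp (epsMap (StrongDual ℝ Z)
        (tmulLeft (v i) : Y →L[ℝ] EpsTensor X Y))) (u i) ≤ ‖Φ‖ * weakNorm 1 v := by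
      simp only [ContinuousLinearMap.comp_apply]
      rw [← map_sum]
      refine (le_abs_self _).trans ((Φ.le_opNorm _).trans ?_)
      exact mul_le_mul_of_nonneg_left (norm_sum_epsMap_le v u hu1) (norm_nonneg _)
    have h3 : ∑ _i : Fin n, δ / (n + 1 : ℝ) ≤ δ := by
      rw [Finset.sum_const, Finset.card_univ, Fintype.card_fin, nsmul_eq_mul, ← mul_div_assoc,
        div_le_iff₀ (by positivity)]
      nlinarith
    linarith
  rcases (weakNorm_one_nonneg v).eq_or_lt with hw | hw
  · have := main Φ₀ hΦ₀
    rw [← hw, mul_zero] at this ⊢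
    exact this
  · rw [← div_le_iff₀ hw]
    refine le_csInf ⟨_, Φ₀, hΦ₀, rfl⟩ ?_
    rintro _ ⟨Φ, hΦ, rfl⟩
    rw [div_le_iff₀ hw]
    exact main Φ hΦ
end
end

section
/- Let X, Y and Z be Banach spaces and let T : X ⊗̂_ε Y → Z be a 1-summing operator. Then for every x ∈ X the operator T# x : Y → Z is 1-summing with π₁(T# x) ≤ ‖x‖ · π₁(T), and moreover T# : X → Π₁(Y,Z) is itself a 1-summing operator. -/
set_option maxHeartbeats 1000000
set_option synthInstance.maxHeartbeats 400000
set_option maxSynthPendingDepth 3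

noncomputable section

open scoped BigOperators NNReal ENNReal
open NormedSpace

section Helpers

variable {E F : Type} [NormedAddCommGroup E] [NormedSpace ℝ E]
  [NormedAddCommGroup F] [NormedSpace ℝ F]

lemma weakNorm_one {n : ℕ} (e : Fin n → E) :
    weakNorm 1 e = ⨆ f : {f : StrongDual ℝ E // ‖f‖ ≤ 1}, ∑ i, ‖(f : StrongDual ℝ E) (e i)‖ := by
  simp [weakNorm]

lemma summing_one {C : ℝ} {T : E →L[ℝ] F} : SummingWithC 1 1 C T ↔
    ∀ (n : ℕ) (e : Fin n → E), ∑ i, ‖T (e i)‖ ≤ C * weakNorm 1 e := by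
  simp [SummingWithC]

lemma le_weakNorm {n : ℕ} (e : Fin n → E) (f : StrongDual ℝ E) (hf : ‖f‖ ≤ 1) :
    ∑ i, ‖f (e i)‖ ≤ weakNorm 1 e := by
  rw [weakNorm_one]
  refine le_ciSup (f := fun f : {f : StrongDual ℝ E // ‖f‖ ≤ 1} =>
    ∑ i, ‖(f : StrongDual ℝ E) (e i)‖) ?_ ⟨f, hf⟩
  refine ⟨∑ i, ‖e i‖, ?_⟩
  rintro _ ⟨g, rfl⟩
  refine Finset.sum_le_sum fun i _ => ?_
  have := g.1.le_of_opNorm_le g.2 (e i)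
  simpa using this

lemma weakNorm_le {n : ℕ} (e : Fin n → E) (B : ℝ)
    (h : ∀ f : StrongDual ℝ E, ‖f‖ ≤ 1 → ∑ i, ‖f (e i)‖ ≤ B) : weakNorm 1 e ≤ B := by
  rw [weakNorm_one]
  haveI : Nonempty {f : StrongDual ℝ E // ‖f‖ ≤ 1} := ⟨⟨0, by simp⟩⟩
  exact ciSup_le fun f => h f.1 f.2

lemma weakNorm_nonneg {n : ℕ} (e : Fin n → E) : 0 ≤ weakNorm 1 e := by
  simpa using le_weakNorm e 0 (by simp)

lemma le_weakNorm' {n : ℕ} (e : Fin n → E) (f : StrongDual ℝ E) :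
    ∑ i, ‖f (e i)‖ ≤ ‖f‖ * weakNorm 1 e := by
  rcases eq_or_ne f 0 with rfl | hf
  · simp
  have hpos : 0 < ‖f‖ := norm_pos_iff.2 hf
  have h := le_weakNorm e (‖f‖⁻¹ • f) (by rw [norm_smul]; simp [hpos.ne'])
  have h2 : ∑ i, ‖(‖f‖⁻¹ • f) (e i)‖ = ‖f‖⁻¹ * ∑ i, ‖f (e i)‖ := by
    rw [Finset.mul_sum]
    exact Finset.sum_congr rfl fun i _ => by simp
  rw [h2, inv_mul_le_iff₀ hpos] at h
  exact h

lemma summing_fintype {C : ℝ} (hC : 0 ≤ C) {T : E →L[ℝ] F} (hT : SummingWithC 1 1 C T)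
    {ι : Type} [Fintype ι] (e : ι → E) (B : ℝ)
    (h : ∀ f : StrongDual ℝ E, ‖f‖ ≤ 1 → ∑ i, ‖f (e i)‖ ≤ B) :
    ∑ i, ‖T (e i)‖ ≤ C * B := by
  let σ := (Fintype.equivFin ι).symm
  rw [← Equiv.sum_comp σ]
  refine (summing_one.1 hT _ (fun i => e (σ i))).trans
    (mul_le_mul_of_nonneg_left (weakNorm_le _ _ fun f hf => ?_) hC)
  rw [Equiv.sum_comp σ (fun i => ‖f (e i)‖)]
  exact h f hf

lemma pNorm_le {C : ℝ} (hC : 0 ≤ C) {T : E →L[ℝ] F} (hT : SummingWithC 1 1 C T) :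
    pNorm 1 T ≤ C :=
  csInf_le ⟨0, fun _ h => h.1⟩ ⟨hC, hT⟩

lemma pNorm_nonneg (T : E →L[ℝ] F) : 0 ≤ pNorm 1 T :=
  Real.sInf_nonneg fun _ h => h.1

lemma pNorm_summing {T : E →L[ℝ] F} (hT : IsPSumming 1 T) : SummingWithC 1 1 (pNorm 1 T) T := by
  obtain ⟨C₀, h₀⟩ := hT
  rw [summing_one]
  intro n e
  refine le_of_forall_pos_le_add fun ε hε => ?_
  have hw := weakNorm_nonneg e
  have hw1 : 0 < weakNorm 1 e + 1 := by linarith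
  obtain ⟨C, hC, hlt⟩ := exists_lt_of_csInf_lt (s := {C | 0 ≤ C ∧ SummingWithC 1 1 C T})
    ⟨C₀, h₀⟩ (show sInf _ < pNorm 1 T + ε / (weakNorm 1 e + 1) from
      lt_add_of_pos_right _ (by positivity))
  have h1 := summing_one.1 hC.2 n e
  have h2 : C * weakNorm 1 e ≤ (pNorm 1 T + ε / (weakNorm 1 e + 1)) * weakNorm 1 e :=
    mul_le_mul_of_nonneg_right hlt.le hw
  have h3 : ε / (weakNorm 1 e + 1) * weakNorm 1 e ≤ ε := by
    rw [div_mul_eq_mul_div, div_le_iff₀ hw1]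
    nlinarith
  linarith

/-- Near-extremal normalised families for the summing norm. -/
lemma exists_family (T : E →L[ℝ] F) (δ : ℝ) (hδ : 0 < δ) :
    ∃ (m : ℕ) (y : Fin m → E), weakNorm 1 y ≤ 1 ∧ pNorm 1 T ≤ ∑ j, ‖T (y j)‖ + δ := by
  rcases lt_or_ge (pNorm 1 T) δ with h | h
  · exact ⟨0, fun _ => 0, weakNorm_le _ _ (by simp), by simpa using h.le⟩
  have hn : ¬ SummingWithC 1 1 (pNorm 1 T - δ) T := fun hs => by
    have := pNorm_le (by linarith) hs
    linarith
  rw [summing_one] at hn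
  push Not at hn
  obtain ⟨m, y, hy⟩ := hn
  have hw := weakNorm_nonneg y
  rcases hw.eq_or_lt with h0 | hpos
  · exfalso
    have hz : ∀ j, y j = 0 := fun j => by
      by_contra hne
      obtain ⟨f, hf, hfy⟩ := exists_dual_vector ℝ (y j) (norm_ne_zero_iff.2 hne)
      have h1 := le_weakNorm y f hf.le
      have h2 := Finset.single_le_sum (f := fun j => ‖f (y j)‖) (fun i _ => norm_nonneg _)
        (Finset.mem_univ j)
      simp only [hfy] at h2
      have h3 : 0 < ‖y j‖ := norm_pos_iff.2 hne
      simp at h1 h2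
      linarith
    simp [hz, ← h0] at hy
  · set w := weakNorm 1 y
    refine ⟨m, fun j => w⁻¹ • y j, weakNorm_le _ _ fun f hf => ?_, ?_⟩
    · have := le_weakNorm y f hf
      simp only [map_smul, norm_smul, ← Finset.mul_sum, norm_inv, Real.norm_of_nonneg hw]
      rw [inv_mul_le_iff₀ hpos]
      simpa using this
    · simp only [map_smul, norm_smul, ← Finset.mul_sum, norm_inv, Real.norm_of_nonneg hw]
      rw [← sub_le_iff_le_add, le_inv_mul_iff₀ hpos]
      linarith

lemma norm_sign_sum_le {n : ℕ} (e : Fin n → E) (a : Fin n → ℝ) (ha : ∀ i, |a i| ≤ 1) :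
    ‖∑ i, a i • e i‖ ≤ weakNorm 1 e := by
  refine norm_le_dual_bound ℝ _ (weakNorm_nonneg e) fun f => ?_
  rw [map_sum]
  refine (norm_sum_le _ _).trans (le_trans (Finset.sum_le_sum fun i _ => ?_)
    ((le_weakNorm' e f).trans_eq (mul_comm _ _)))
  rw [map_smul, norm_smul]
  exact mul_le_of_le_one_left (norm_nonneg _) (ha i)

end Helpers

section HelpersEps

variable {X Y : Type} [NormedAddCommGroup X] [NormedSpace ℝ X]
  [NormedAddCommGroup Y] [NormedSpace ℝ Y]

def toOp : EpsTensor X Y →ₗ[ℝ] (StrongDual ℝ X →L[ℝ] Y) := (epsSub X Y).subtype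

lemma norm_toOp (u : EpsTensor X Y) : ‖toOp u‖ = ‖u‖ := rfl

lemma toOp_tmulLeft (x : X) (y : Y) (f : StrongDual ℝ X) : toOp (tmulLeft x y) f = f x • y := rfl

lemma norm_tmulLeft_le (x : X) : ‖(tmulLeft x : Y →L[ℝ] EpsTensor X Y)‖ ≤ ‖x‖ := by
  refine ContinuousLinearMap.opNorm_le_bound _ (norm_nonneg _) fun y => ?_
  rw [← norm_toOp]
  refine ContinuousLinearMap.opNorm_le_bound _ (by positivity) fun f => ?_
  rw [toOp_tmulLeft, norm_smul]
  have := f.le_opNorm x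
  calc ‖f x‖ * ‖y‖ ≤ (‖f‖ * ‖x‖) * ‖y‖ := by gcongr
    _ = _ := by ring

lemma weak_tensor_le {n : ℕ} (v : Fin n → X) (m : Fin n → ℕ) (y : ∀ i, Fin (m i) → Y)
    (hy : ∀ i, weakNorm 1 (y i) ≤ 1) (φ : StrongDual ℝ (EpsTensor X Y)) (hφ : ‖φ‖ ≤ 1) :
    ∑ p : (Σ i, Fin (m i)), ‖φ (tmulLeft (v p.1) (y p.1 p.2))‖ ≤ weakNorm 1 v := by
  let a : ∀ i, Fin (m i) → ℝ := fun i j => SignType.sign (φ (tmulLeft (v i) (y i j)))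
  have ha : ∀ i j, |a i j| ≤ 1 := fun i j => by
    simp only [a]
    rcases SignType.sign (φ (tmulLeft (v i) (y i j))) with _ | _ | _ <;> simp
  let u : EpsTensor X Y := ∑ i, ∑ j, a i j • tmulLeft (v i) (y i j)
  have h1 : ∑ p : (Σ i, Fin (m i)), ‖φ (tmulLeft (v p.1) (y p.1 p.2))‖ = φ u := by
    rw [Fintype.sum_sigma]
    simp only [u, map_sum, map_smul, smul_eq_mul, a, Real.norm_eq_abs, sign_mul_self]
  have h2 : ‖u‖ ≤ weakNorm 1 v := by
    rw [← norm_toOp]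
    refine ContinuousLinearMap.opNorm_le_bound _ (weakNorm_nonneg v) fun f => ?_
    have h3 : toOp u f = ∑ i, f (v i) • ∑ j, a i j • y i j := by
      simp only [u, map_sum, map_smul, ContinuousLinearMap.sum_apply,
        ContinuousLinearMap.smul_apply, toOp_tmulLeft, Finset.smul_sum]
      exact Finset.sum_congr rfl fun i _ => Finset.sum_congr rfl fun j _ => smul_comm _ _ _
    rw [h3]
    refine (norm_sum_le _ _).trans (le_trans (Finset.sum_le_sum fun i _ => ?_)
      ((le_weakNorm' v f).trans_eq (mul_comm _ _)))
    rw [norm_smul]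
    exact mul_le_of_le_one_right (norm_nonneg _)
      ((norm_sign_sum_le (y i) (a i) (ha i)).trans (hy i))
  rw [h1]
  refine (le_abs_self _).trans ((φ.le_of_opNorm_le hφ u).trans ?_)
  simpa using h2

end HelpersEps

/-- if `T : X ⊗̂_ε Y → Z` is a 1-summing operator, then for every `x ∈ X` the
operator `T# x : Y → Z` is 1-summing with `π₁(T# x) ≤ ‖x‖ · π₁(T)`, and moreover
`T# : X → Π₁(Y,Z)` is itself 1-summing, i.e. there is `C ≥ 0` with
`Σ_i π₁(T# x_i) ≤ C · sup { Σ_i |x*(x_i)| : ‖x*‖ ≤ 1 }` for all finite families in `X`. -/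
theorem statement7 (X Y Z : Type)
    [NormedAddCommGroup X] [NormedSpace ℝ X] [CompleteSpace X]
    [NormedAddCommGroup Y] [NormedSpace ℝ Y] [CompleteSpace Y]
    [NormedAddCommGroup Z] [NormedSpace ℝ Z] [CompleteSpace Z]
    (T : EpsTensor X Y →L[ℝ] Z) (hT : IsPSumming 1 T) :
    (∀ x : X, IsPSumming 1 (sharp T x) ∧ pNorm 1 (sharp T x) ≤ ‖x‖ * pNorm 1 T) ∧
    ∃ C, 0 ≤ C ∧ ∀ (n : ℕ) (v : Fin n → X),
      ∑ i, pNorm 1 (sharp T (v i)) ≤ C * weakNorm 1 v := by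
  constructor
  · intro x
    have key : SummingWithC 1 1 (‖x‖ * pNorm 1 T) (sharp T x) := by
      rw [summing_one]
      intro n e
      have h := summing_fintype (pNorm_nonneg T) (pNorm_summing hT)
        (fun i => tmulLeft x (e i)) (‖x‖ * weakNorm 1 e) (fun f hf => by
          refine (le_weakNorm' e (f.comp (tmulLeft x))).trans
            (mul_le_mul_of_nonneg_right ?_ (weakNorm_nonneg e))
          refine (ContinuousLinearMap.opNorm_comp_le _ _).trans ?_
          exact (mul_le_of_le_one_left (norm_nonneg _) hf).trans (norm_tmulLeft_le x))
      calc _ ≤ _ := h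
        _ = _ := by ring
    have h0 : 0 ≤ ‖x‖ * pNorm 1 T := mul_nonneg (norm_nonneg _) (pNorm_nonneg T)
    exact ⟨⟨_, h0, key⟩, pNorm_le h0 key⟩
  · refine ⟨pNorm 1 T, pNorm_nonneg T, fun n v => ?_⟩
    refine le_of_forall_pos_le_add fun ε hε => ?_
    have hδ : 0 < ε / (n + 1) := by positivity
    choose m y hy hp using fun i => exists_family (sharp T (v i)) (ε / (n + 1)) hδ
    have h := summing_fintype (pNorm_nonneg T) (pNorm_summing hT)
      (fun p : (Σ i, Fin (m i)) => tmulLeft (v p.1) (y p.1 p.2)) _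
      (weak_tensor_le v m y hy)
    rw [Fintype.sum_sigma] at h
    have h2 := Finset.sum_le_sum fun i (_ : i ∈ Finset.univ) => hp i
    rw [Finset.sum_add_distrib] at h2
    simp only [Finset.sum_const, Finset.card_univ, Fintype.card_fin, nsmul_eq_mul] at h2
    have h3 : (n : ℝ) * (ε / (n + 1)) ≤ ε := by
      rw [mul_div_assoc', div_le_iff₀ (by positivity)]
      nlinarith
    have h4 : ∑ i, ∑ j, ‖sharp T (v i) (y i j)‖ ≤ pNorm 1 T * weakNorm 1 v := h
    linarith
end
end
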